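/- For any two matrices A, B ∈ SU(2), the traces tr A, tr B and tr(AB) are real, tr A and tr B lie in [−2,2], and tr(AB) lies in the interval I_{tr A, tr B}; equivalently, |2·tr(AB) − (tr A)(tr B)| ≤ √((4 − (tr A)²)(4 − (tr B)²)). -/

import Mathlib

open Matrix

/-- The interval `I_{s,t} = [(st − √((4−s²)(4−t²)))/2, (st + √((4−s²)(4−t²)))/2]`. -/
def Ist (s t : ℝ) : Set ℝ :=
  Set.Icc ((s * t - Real.sqrt ((4 - s ^ 2) * (4 - t ^ 2))) / 2)
          ((s * t + Real.sqrt ((4 - s ^ 2) * (4 - t ^ 2))) / 2)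

/-- Every matrix in `SU(2)` is a unit quaternion `x + yi + zj + wk` in matrix form. -/
theorem exists_quaternion_coords_of_mem_SU2 {A : Matrix (Fin 2) (Fin 2) ℂ}
    (hA : A ∈ Matrix.unitaryGroup (Fin 2) ℂ) (hdet : A.det = 1) :
    ∃ x y z w : ℝ, x ^ 2 + y ^ 2 + z ^ 2 + w ^ 2 = 1 ∧
      A = !![⟨x, y⟩, ⟨z, w⟩; ⟨-z, w⟩, ⟨x, -y⟩] := by
  have hstar : star A = A.adjugate := by
    calc star A = star A * (A * A.adjugate) := by rw [Matrix.mul_adjugate, hdet]; simp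
      _ = A.adjugate := by
        rw [← Matrix.mul_assoc, Matrix.mem_unitaryGroup_iff'.mp hA, Matrix.one_mul]
  rw [Matrix.adjugate_fin_two] at hstar
  have h0 : star (A 0 0) = A 1 1 := by simpa using congrFun₂ hstar 0 0
  have h1 : star (A 0 1) = -A 1 0 := by simpa using congrFun₂ hstar 1 0
  obtain ⟨h0r, h0i⟩ := Complex.ext_iff.mp h0
  obtain ⟨h1r, h1i⟩ := Complex.ext_iff.mp h1
  simp only [Complex.star_def, Complex.conj_re, Complex.conj_im, Complex.neg_re,
    Complex.neg_im] at h0r h0i h1r h1i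
  refine ⟨(A 0 0).re, (A 0 0).im, (A 0 1).re, (A 0 1).im, ?_, ?_⟩
  · have hre := congrArg Complex.re hdet
    rw [Matrix.det_fin_two, Complex.sub_re, Complex.mul_re, Complex.mul_re, Complex.one_re,
      ← h0r, ← h0i, ← neg_eq_iff_eq_neg.mpr h1r, show (A 1 0).im = (A 0 1).im by linarith] at hre
    linarith
  · ext i j
    fin_cases i <;> fin_cases j <;> apply Complex.ext <;> simp <;> linarith

theorem abs_dot_le_sqrt {x₁ y₁ z₁ w₁ x₂ y₂ z₂ w₂ : ℝ}
    (h₁ : x₁ ^ 2 + y₁ ^ 2 + z₁ ^ 2 + w₁ ^ 2 = 1)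
    (h₂ : x₂ ^ 2 + y₂ ^ 2 + z₂ ^ 2 + w₂ ^ 2 = 1) :
    |4 * (y₁ * y₂ + z₁ * z₂ + w₁ * w₂)| ≤
      √((4 - (2 * x₁) ^ 2) * (4 - (2 * x₂) ^ 2)) := by
  apply Real.abs_le_sqrt
  rw [show 4 - (2 * x₁) ^ 2 = 4 * (y₁ ^ 2 + z₁ ^ 2 + w₁ ^ 2) by linarith,
    show 4 - (2 * x₂) ^ 2 = 4 * (y₂ ^ 2 + z₂ ^ 2 + w₂ ^ 2) by linarith]
  nlinarith [sq_nonneg (y₁ * z₂ - z₁ * y₂), sq_nonneg (y₁ * w₂ - w₁ * y₂),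
    sq_nonneg (z₁ * w₂ - w₁ * z₂)]

/-- For `A, B ∈ SU(2)`: the traces `tr A`, `tr B`, `tr(AB)` are real,
`tr A, tr B ∈ [-2,2]`, and `tr(AB) ∈ I_{tr A, tr B}`; equivalently
`|2·tr(AB) − (tr A)(tr B)| ≤ √((4 − (tr A)²)(4 − (tr B)²))`. -/
theorem su2_trace_product_interval
    (A B : Matrix (Fin 2) (Fin 2) ℂ)
    (hA : A ∈ Matrix.unitaryGroup (Fin 2) ℂ) (hA1 : A.det = 1)
    (hB : B ∈ Matrix.unitaryGroup (Fin 2) ℂ) (hB1 : B.det = 1) :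
    A.trace.im = 0 ∧ B.trace.im = 0 ∧ (A * B).trace.im = 0 ∧
    A.trace.re ∈ Set.Icc (-2 : ℝ) 2 ∧ B.trace.re ∈ Set.Icc (-2 : ℝ) 2 ∧
    (A * B).trace.re ∈ Ist A.trace.re B.trace.re ∧
    |2 * (A * B).trace.re - A.trace.re * B.trace.re| ≤
      Real.sqrt ((4 - A.trace.re ^ 2) * (4 - B.trace.re ^ 2)) := by
  obtain ⟨x₁, y₁, z₁, w₁, h₁, rfl⟩ := exists_quaternion_coords_of_mem_SU2 hA hA1
  obtain ⟨x₂, y₂, z₂, w₂, h₂, rfl⟩ := exists_quaternion_coords_of_mem_SU2 hB hB1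
  have hbound := abs_dot_le_sqrt h₁ h₂
  simp only [Matrix.mul_fin_two, Matrix.trace_fin_two_of, Complex.add_re, Complex.add_im,
    Complex.mul_re, Complex.mul_im, ← two_mul, Ist, Set.mem_Icc]
  have habs := abs_le.mp hbound
  refine ⟨by ring, by ring, by ring, ⟨?_, ?_⟩, ⟨?_, ?_⟩, ⟨?_, ?_⟩, ?_⟩
  · nlinarith
  · nlinarith
  · nlinarith
  · nlinarith
  · linarith
  · linarith
  · rw [← abs_neg]
    convert hbound using 2
    ring
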